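/- Let n ≥ 3, let R be a commutative ring, and let A,B be ideals of R. Then [E(n,R,A), SL(n,R,B)] = [E(n,R,A), E(n,R,B)], where SL(n,R,B) denotes the principal congruence subgroup of level B. -/

import Mathlib

open Matrix

/-- The elementary transvection `e + ξ e_{ij}` as an element of `SL(n,R)`. -/
def elemT {n : ℕ} {R : Type*} [CommRing R] (i j : Fin n) (hij : i ≠ j) (ξ : R) :
    Matrix.SpecialLinearGroup (Fin n) R :=
  ⟨Matrix.transvection i j ξ, Matrix.det_transvection_of_ne i j hij ξ⟩

/-- The set of elementary transvections in `SL(n,R)`. -/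
def elemSet (n : ℕ) (R : Type*) [CommRing R] :
    Set (Matrix.SpecialLinearGroup (Fin n) R) :=
  { g | ∃ i j : Fin n, ∃ hij : i ≠ j, ∃ ξ : R, g = elemT i j hij ξ }

/-- The elementary subgroup `E(n,R)` of `SL(n,R)`. -/
def elemSubgroup (n : ℕ) (R : Type*) [CommRing R] :
    Subgroup (Matrix.SpecialLinearGroup (Fin n) R) :=
  Subgroup.closure (elemSet n R)

/-- The set of elementary transvections of level `I`. -/
def elemSetIdeal (n : ℕ) {R : Type*} [CommRing R] (I : Ideal R) :
    Set (Matrix.SpecialLinearGroup (Fin n) R) :=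
  { g | ∃ i j : Fin n, ∃ hij : i ≠ j, ∃ ξ : R, ξ ∈ I ∧ g = elemT i j hij ξ }

/-- The subgroup `E(n,I)` generated by the elementary transvections of level `I`. -/
def elemSubgroupIdeal (n : ℕ) {R : Type*} [CommRing R] (I : Ideal R) :
    Subgroup (Matrix.SpecialLinearGroup (Fin n) R) :=
  Subgroup.closure (elemSetIdeal n I)

/-- The relative elementary subgroup `E(n,R,I)`: the normal closure of `E(n,I)`
in `E(n,R)`. -/
def relElemSubgroup (n : ℕ) {R : Type*} [CommRing R] (I : Ideal R) :
    Subgroup (Matrix.SpecialLinearGroup (Fin n) R) :=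
  Subgroup.closure
    { g | ∃ h ∈ elemSubgroup n R, ∃ x ∈ elemSubgroupIdeal n I, g = h * x * h⁻¹ }

/-- The principal congruence subgroup `SL(n,R,I)`: the kernel of reduction modulo `I`. -/
def congrSubgroup (n : ℕ) {R : Type*} [CommRing R] (I : Ideal R) :
    Subgroup (Matrix.SpecialLinearGroup (Fin n) R) :=
  (Matrix.SpecialLinearGroup.map (Ideal.Quotient.mk I)).ker

/-- The elementary generator `z_{ij}(ξ,ζ) = t_{ji}(ζ) t_{ij}(ξ) t_{ji}(−ζ)` of the
relative elementary subgroup. -/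
def zElem {n : ℕ} {R : Type*} [CommRing R] (i j : Fin n) (hij : i ≠ j) (ξ ζ : R) :
    Matrix.SpecialLinearGroup (Fin n) R :=
  elemT j i hij.symm ζ * elemT i j hij ξ * elemT j i hij.symm (-ζ)

/-- The set of elementary generators `z_{ij}(ξ,ζ)`, `ξ ∈ I`, `ζ ∈ R`, of `E(n,R,I)`. -/
def zSet (n : ℕ) {R : Type*} [CommRing R] (I : Ideal R) :
    Set (Matrix.SpecialLinearGroup (Fin n) R) :=
  { g | ∃ i j : Fin n, ∃ hij : i ≠ j, ∃ ξ ∈ I, ∃ ζ : R, g = zElem i j hij ξ ζ }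

open Matrix.SpecialLinearGroup (coeMonoidHom coeMonoidHom_injective)

section Elementary

open scoped commutatorElement

variable {n : ℕ} {R S : Type*} [CommRing R] [CommRing S]

theorem elemT_mul {i j : Fin n} (hij : i ≠ j) (ξ ζ : R) :
    elemT i j hij ξ * elemT i j hij ζ = elemT i j hij (ξ + ζ) :=
  Subtype.ext (Matrix.transvection_mul_transvection_same i j hij ξ ζ)

theorem elemT_inv {i j : Fin n} (hij : i ≠ j) (ξ : R) :
    (elemT i j hij ξ)⁻¹ = elemT i j hij (-ξ) := by
  rw [inv_eq_iff_mul_eq_one, elemT_mul, add_neg_cancel]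
  exact Subtype.ext (Matrix.transvection_zero i j)

theorem commutator_elemT {i k j : Fin n} (hik : i ≠ k) (hkj : k ≠ j) (hij : i ≠ j) (ξ ζ : R) :
    ⁅elemT i k hik ξ, elemT k j hkj ζ⁆ = elemT i j hij (ξ * ζ) := by
  rw [commutatorElement_def, elemT_inv, elemT_inv]
  apply Subtype.ext
  have hneg : ∀ (a b : Fin n) (c : R), Matrix.single a b (-c) = -Matrix.single a b c :=
    fun a b c => (Matrix.single_neg a b c).symm
  change (1 + Matrix.single i k ξ) * (1 + Matrix.single k j ζ) * (1 + Matrix.single i k (-ξ)) *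
    (1 + Matrix.single k j (-ζ)) = 1 + Matrix.single i j (ξ * ζ)
  simp [mul_add, add_mul, hik.symm, hkj.symm, hij.symm, hneg]
  abel

theorem map_elemT (f : R →+* S) {i j : Fin n} (hij : i ≠ j) (ξ : R) :
    Matrix.SpecialLinearGroup.map f (elemT i j hij ξ) = elemT i j hij (f ξ) := by
  apply Subtype.ext
  ext a b
  change f (Matrix.transvection i j ξ a b) = Matrix.transvection i j (f ξ) a b
  simp [Matrix.transvection, Matrix.single_apply, Matrix.one_apply, apply_ite f]

theorem elemT_mem_elemSubgroup {i j : Fin n} (hij : i ≠ j) (ξ : R) :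
    elemT i j hij ξ ∈ elemSubgroup n R :=
  Subgroup.subset_closure ⟨i, j, hij, ξ, rfl⟩

theorem elemSubgroupIdeal_le_relElemSubgroup (I : Ideal R) :
    elemSubgroupIdeal n I ≤ relElemSubgroup n I := fun x hx =>
  Subgroup.subset_closure ⟨1, one_mem _, x, hx, by simp⟩

theorem elemT_mem_relElemSubgroup {I : Ideal R} {i j : Fin n} (hij : i ≠ j) {ξ : R} (hξ : ξ ∈ I) :
    elemT i j hij ξ ∈ relElemSubgroup n I :=
  elemSubgroupIdeal_le_relElemSubgroup I (Subgroup.subset_closure ⟨i, j, hij, ξ, hξ, rfl⟩)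

/-- A subgroup normalised by `E(n,R)` that contains the transvections of level `I`
contains `E(n,R,I)`. -/
theorem relElemSubgroup_le {I : Ideal R} {H : Subgroup (Matrix.SpecialLinearGroup (Fin n) R)}
    (hH : ∀ h ∈ elemSubgroup n R, ∀ x ∈ H, h * x * h⁻¹ ∈ H)
    (hI : ∀ (i j : Fin n) (hij : i ≠ j), ∀ ξ ∈ I, elemT i j hij ξ ∈ H) :
    relElemSubgroup n I ≤ H := by
  have hle : elemSubgroupIdeal n I ≤ H := by
    refine (Subgroup.closure_le _).2 ?_
    rintro _ ⟨i, j, hij, ξ, hξ, rfl⟩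
    exact hI i j hij ξ hξ
  refine (Subgroup.closure_le _).2 ?_
  rintro _ ⟨h, hh, x, hx, rfl⟩
  exact hH h hh x (hle hx)

theorem relElemSubgroup_conj_mem {I : Ideal R} {h x : Matrix.SpecialLinearGroup (Fin n) R}
    (hh : h ∈ elemSubgroup n R) (hx : x ∈ relElemSubgroup n I) :
    h * x * h⁻¹ ∈ relElemSubgroup n I := by
  have hle : relElemSubgroup n I ≤
      (relElemSubgroup n I).comap (MulAut.conj h).toMonoidHom := by
    refine (Subgroup.closure_le _).2 ?_
    rintro _ ⟨k, hk, y, hy, rfl⟩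
    exact Subgroup.subset_closure ⟨h * k, mul_mem hh hk, y, hy, by simp [mul_assoc]⟩
  exact hle hx

theorem relElemSubgroup_le_elemSubgroup (I : Ideal R) :
    relElemSubgroup n I ≤ elemSubgroup n R :=
  relElemSubgroup_le (fun _ hh _ hx => mul_mem (mul_mem hh hx) (inv_mem hh))
    fun _ _ hij ξ _ => elemT_mem_elemSubgroup hij ξ

theorem relElemSubgroup_top : relElemSubgroup n (⊤ : Ideal R) = elemSubgroup n R := by
  refine (relElemSubgroup_le_elemSubgroup _).antisymm ((Subgroup.closure_le _).2 ?_)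
  rintro _ ⟨i, j, hij, ξ, rfl⟩
  exact elemT_mem_relElemSubgroup hij trivial

theorem map_mem_elemSubgroup (f : R →+* S) {x : Matrix.SpecialLinearGroup (Fin n) R}
    (hx : x ∈ elemSubgroup n R) : Matrix.SpecialLinearGroup.map f x ∈ elemSubgroup n S := by
  have hle : elemSubgroup n R ≤
      (elemSubgroup n S).comap (Matrix.SpecialLinearGroup.map f) := by
    refine (Subgroup.closure_le _).2 ?_
    rintro _ ⟨i, j, hij, ξ, rfl⟩
    simpa [map_elemT] using elemT_mem_elemSubgroup hij (f ξ)
  exact hle hx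

theorem map_mem_relElemSubgroup (f : R →+* S) {I : Ideal R} {J : Ideal S} (hIJ : I ≤ J.comap f)
    {x : Matrix.SpecialLinearGroup (Fin n) R} (hx : x ∈ relElemSubgroup n I) :
    Matrix.SpecialLinearGroup.map f x ∈ relElemSubgroup n J := by
  have hle : relElemSubgroup n I ≤
      (relElemSubgroup n J).comap (Matrix.SpecialLinearGroup.map f) := by
    refine relElemSubgroup_le (fun h hh x hx => ?_) fun i j hij ξ hξ => ?_
    · simpa using relElemSubgroup_conj_mem (map_mem_elemSubgroup f hh) hx
    · rw [Subgroup.mem_comap, map_elemT]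
      exact elemT_mem_relElemSubgroup (I := J) hij (hIJ hξ)
  exact hle hx

/-- The matrices underlying the elements of `E(n,R,I)`. -/
def relElemMatrices (n : ℕ) {R : Type*} [CommRing R] (I : Ideal R) :
    Submonoid (Matrix (Fin n) (Fin n) R) :=
  (relElemSubgroup n I).toSubmonoid.map coeMonoidHom

theorem coe_mem_relElemMatrices {I : Ideal R} {g : Matrix.SpecialLinearGroup (Fin n) R} :
    (g : Matrix (Fin n) (Fin n) R) ∈ relElemMatrices n I ↔ g ∈ relElemSubgroup n I := by
  constructor
  · rintro ⟨x, hx, hxg⟩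
    rwa [← coeMonoidHom_injective hxg]
  · exact fun hg => ⟨g, hg, rfl⟩

theorem one_add_single_mem_relElemMatrices {I : Ideal R} {i j : Fin n} (hij : i ≠ j) {ξ : R}
    (hξ : ξ ∈ I) : 1 + Matrix.single i j ξ ∈ relElemMatrices n I :=
  coe_mem_relElemMatrices.2 (elemT_mem_relElemSubgroup hij hξ)

theorem one_add_sum_mem {ι M : Type*} [Ring M] {K : Submonoid M} (s : Finset ι) (X : ι → M)
    (h0 : ∀ a b, X a * X b = 0) (hX : ∀ a, 1 + X a ∈ K) : 1 + ∑ a ∈ s, X a ∈ K := by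
  classical
  induction s using Finset.induction_on with
  | empty => simp
  | insert a s ha ih =>
    have hmul : 1 + ∑ b ∈ insert a s, X b = (1 + X a) * (1 + ∑ b ∈ s, X b) := by
      rw [Finset.sum_insert ha, add_mul, one_mul, mul_add, mul_one, Finset.mul_sum]
      simp only [h0, Finset.sum_const_zero]
      abel
    rw [hmul]
    exact mul_mem (hX a) ih

theorem one_add_vecMulVec_single_right_mem {I : Ideal R} {x : Fin n → R} {l : Fin n}
    (hl : x l = 0) (hx : ∀ m, x m ∈ I) :
    1 + Matrix.vecMulVec x (Pi.single l 1) ∈ relElemMatrices n I := by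
  have hsum : Matrix.vecMulVec x (Pi.single l 1) = ∑ m, Matrix.single m l (x m) := by
    ext a b
    simp [Matrix.vecMulVec_apply, Matrix.sum_apply, Matrix.single_apply, Pi.single_apply,
      ite_and, eq_comm]
  rw [hsum]
  refine one_add_sum_mem _ _ (fun a b => ?_) fun m => ?_
  · by_cases hb : l = b
    · subst hb; simp [hl]
    · simp [hb]
  · by_cases hm : m = l
    · subst hm; simp [hl]
    · exact one_add_single_mem_relElemMatrices hm (hx m)

theorem one_add_vecMulVec_single_left_mem {I : Ideal R} {v : Fin n → R} {l : Fin n}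
    (hl : v l = 0) (hv : ∀ m, v m ∈ I) :
    1 + Matrix.vecMulVec (Pi.single l 1) v ∈ relElemMatrices n I := by
  have hsum : Matrix.vecMulVec (Pi.single l 1) v = ∑ m, Matrix.single l m (v m) := by
    ext a b
    simp [Matrix.vecMulVec_apply, Matrix.sum_apply, Matrix.single_apply, Pi.single_apply,
      ite_and, eq_comm]
  rw [hsum]
  refine one_add_sum_mem _ _ (fun a b => ?_) fun m => ?_
  · by_cases ha : a = l
    · subst ha; simp [hl]
    · simp [ha]
  · by_cases hm : l = m
    · subst hm; simp [hl]
    · exact one_add_single_mem_relElemMatrices hm (hv m)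

theorem conj_mem_relElemMatrices {I : Ideal R} {X Y Z : Matrix (Fin n) (Fin n) R}
    (hX : X ∈ relElemMatrices n I) (hY : Y ∈ relElemMatrices n (⊤ : Ideal R)) (hYZ : Y * Z = 1) :
    Y * X * Z ∈ relElemMatrices n I := by
  obtain ⟨x, hx, rfl⟩ := hX
  obtain ⟨y, hy, rfl⟩ := hY
  have hZ : Z = coeMonoidHom y⁻¹ := by
    calc Z = coeMonoidHom y⁻¹ * (coeMonoidHom y * Z) := by
          rw [← mul_assoc, ← map_mul, inv_mul_cancel, map_one, one_mul]
      _ = coeMonoidHom y⁻¹ := by rw [hYZ, mul_one]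
  rw [hZ, ← map_mul, ← map_mul]
  exact ⟨_, relElemSubgroup_conj_mem (relElemSubgroup_le_elemSubgroup _ hy) hx, rfl⟩

/-- If `v` has a zero coordinate and its entries lie in `I`, then `e + uv` lies in `E(n,R,I)`. -/
theorem one_add_vecMulVec_mem_of_apply_eq_zero {I : Ideal R} {u v : Fin n → R} {l : Fin n}
    (hvu : v ⬝ᵥ u = 0) (hl : v l = 0) (hv : ∀ m, v m ∈ I) :
    1 + Matrix.vecMulVec u v ∈ relElemMatrices n I := by
  set x : Fin n → R := u - u l • Pi.single l 1 with hx
  have hxl : x l = 0 := by simp [hx]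
  have hvx : v ⬝ᵥ x = 0 := by simp [hx, dotProduct_sub, hvu, hl]
  set X := Matrix.vecMulVec x (Pi.single l 1 : Fin n → R) with hXdef
  set V := Matrix.vecMulVec (Pi.single l 1 : Fin n → R) v with hVdef
  have hXX : X * X = 0 := by simp [hXdef, Matrix.vecMulVec_mul_vecMulVec, hxl]
  have hVV : V * V = 0 := by simp [hVdef, Matrix.vecMulVec_mul_vecMulVec, hl]
  have hVX : V * X = 0 := by simp [hXdef, hVdef, Matrix.vecMulVec_mul_vecMulVec, hvx]
  have hXV : X * V = Matrix.vecMulVec x v := by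
    simp [hXdef, hVdef, Matrix.vecMulVec_mul_vecMulVec]
  have huv : Matrix.vecMulVec u v = X * V + u l • V := by
    rw [hXV, hVdef, ← Matrix.smul_vecMulVec, ← Matrix.add_vecMulVec, hx, sub_add_cancel]
  have hV : ∀ c : R, 1 + c • V ∈ relElemMatrices n I := fun c => by
    rw [hVdef, ← Matrix.vecMulVec_smul]
    exact one_add_vecMulVec_single_left_mem (by simp [hl]) fun m => I.mul_mem_left c (hv m)
  have hconj : (1 + X) * (1 + (1 : R) • V) * (1 - X) ∈ relElemMatrices n I :=
    conj_mem_relElemMatrices (hV 1)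
      (one_add_vecMulVec_single_right_mem hxl fun _ => trivial)
      (by rw [add_mul, mul_sub, mul_sub, hXX]; simp)
  have hXVX : X * V * X = 0 := by rw [mul_assoc, hVX, mul_zero]
  have hXVV : X * V * V = 0 := by rw [mul_assoc, hVV, mul_zero]
  have hprod : 1 + Matrix.vecMulVec u v =
      (1 + X) * (1 + (1 : R) • V) * (1 - X) * (1 + (u l - 1) • V) := by
    rw [huv, one_smul]
    simp only [mul_add, add_mul, mul_sub, sub_mul, mul_one, one_mul, hXX, hVX, hXVX, mul_smul_comm,
      hVV, hXVV, zero_mul]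
    module
  rw [hprod]
  exact mul_mem hconj (hV _)

theorem exists_ne_ne (hn : 3 ≤ n) (i j : Fin n) : ∃ k, i ≠ k ∧ k ≠ j := by
  obtain ⟨k, hk⟩ : ∃ k, k ∉ ({i, j} : Finset (Fin n)) := by
    by_contra! h
    have hcard := Finset.card_le_card (fun l _ => h l : Finset.univ ⊆ {i, j})
    have := Finset.card_le_two (a := i) (b := j)
    rw [Finset.card_univ, Fintype.card_fin] at hcard
    omega
  simp only [Finset.mem_insert, Finset.mem_singleton, not_or] at hk
  exact ⟨k, Ne.symm hk.1, hk.2⟩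

/-- If `u` is unimodular, `v` is orthogonal to `u` and the entries of `v` lie in `I`, then
`e + uv` lies in `E(n,R,I)`. -/
theorem one_add_vecMulVec_mem (hn : 3 ≤ n) {I : Ideal R} {u v w : Fin n → R}
    (hwu : w ⬝ᵥ u = 1) (hvu : v ⬝ᵥ u = 0) (hv : ∀ m, v m ∈ I) :
    1 + Matrix.vecMulVec u v ∈ relElemMatrices n I := by
  let y : Fin n × Fin n → Fin n → R := fun p =>
    (w p.1 * v p.2) • (u p.1 • Pi.single p.2 1 - u p.2 • Pi.single p.1 1)
  have hyu : ∀ p, y p ⬝ᵥ u = 0 := fun p => by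
    simp [y, sub_dotProduct, mul_comm]
  have hsum : Matrix.vecMulVec u v = ∑ p, Matrix.vecMulVec u (y p) := by
    ext a b
    have hb : v b = ∑ p, y p b := by
      simp only [dotProduct] at hwu hvu
      simp only [y, Fintype.sum_prod_type, Pi.smul_apply, Pi.sub_apply, smul_eq_mul, mul_sub,
        Finset.sum_sub_distrib, Pi.single_apply, mul_ite, mul_one, mul_zero, Finset.sum_ite_eq,
        Finset.mem_univ, if_true]
      have h1 : ∑ k, w k * v b * u k = v b := by
        calc ∑ k, w k * v b * u k = v b * ∑ k, w k * u k := by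
              rw [Finset.mul_sum]
              exact Finset.sum_congr rfl fun k _ => by ring
          _ = v b := by rw [hwu, mul_one]
      have h2 : ∑ j, w b * v j * u j = 0 := by
        rw [← mul_zero (w b), ← hvu, Finset.mul_sum]
        exact Finset.sum_congr rfl fun k _ => by ring
      rw [h1, Finset.sum_comm]
      simp [h2]
    simp only [Matrix.sum_apply, Matrix.vecMulVec_apply, ← Finset.mul_sum, ← hb]
  rw [hsum]
  refine one_add_sum_mem _ _ (fun p q => ?_) fun p => ?_
  · simp [Matrix.vecMulVec_mul_vecMulVec, hyu]
  · obtain ⟨l, hl1, hl2⟩ := exists_ne_ne hn p.1 p.2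
    refine one_add_vecMulVec_mem_of_apply_eq_zero (l := l) (hyu p) ?_ fun m => ?_
    · simp [y, hl1.symm, hl2]
    · exact I.mul_mem_right _ (I.mul_mem_left _ (hv _))

theorem conj_elemT_mem (hn : 3 ≤ n) {I : Ideal R} (g : Matrix.SpecialLinearGroup (Fin n) R)
    {i j : Fin n} (hij : i ≠ j) {ξ : R} (hξ : ξ ∈ I) :
    g * elemT i j hij ξ * g⁻¹ ∈ relElemSubgroup n I := by
  rw [← coe_mem_relElemMatrices]
  set G : Matrix (Fin n) (Fin n) R := g.1 with hG
  set G' : Matrix (Fin n) (Fin n) R := (g⁻¹).1 with hG'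
  have hGG' : G * G' = 1 := by
    rw [hG, hG', ← Matrix.SpecialLinearGroup.coe_mul, mul_inv_cancel]; rfl
  have hG'G : G' * G = 1 := by
    rw [hG, hG', ← Matrix.SpecialLinearGroup.coe_mul, inv_mul_cancel]; rfl
  have hrow : ∀ a b, (fun c => G' a c) ⬝ᵥ (fun c => G c b) = (1 : Matrix (Fin n) (Fin n) R) a b :=
    fun a b => by rw [← hG'G]; rfl
  have hmat : ((g * elemT i j hij ξ * g⁻¹ : Matrix.SpecialLinearGroup (Fin n) R) :
      Matrix (Fin n) (Fin n) R) =
      1 + Matrix.vecMulVec (fun c => G c i) (ξ • fun c => G' j c) := by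
    simp only [Matrix.SpecialLinearGroup.coe_mul]
    change G * (1 + Matrix.single i j ξ) * G' = _
    rw [mul_add, add_mul, mul_one, hGG']
    congr 1
    ext a b
    simp [Matrix.mul_apply, Matrix.single_apply, Matrix.vecMulVec_apply, ite_and, mul_assoc]
  rw [hmat]
  refine one_add_vecMulVec_mem (w := fun c => G' i c) hn (by simp [hrow]) ?_ fun m =>
    I.mul_mem_right _ hξ
  rw [smul_dotProduct, hrow, Matrix.one_apply_ne hij.symm, smul_zero]

/-- Suslin's normality theorem: `E(n,R,I)` is normal in `SL(n,R)` for `n ≥ 3`. -/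
theorem relElemSubgroup_normal (hn : 3 ≤ n) (I : Ideal R) : (relElemSubgroup n I).Normal := by
  refine ⟨fun x hx g => ?_⟩
  have hle : elemSubgroupIdeal n I ≤ ⨅ g : Matrix.SpecialLinearGroup (Fin n) R,
      (relElemSubgroup n I).comap (MulAut.conj g).toMonoidHom := by
    refine (Subgroup.closure_le _).2 ?_
    rintro _ ⟨i, j, hij, ξ, hξ, rfl⟩
    exact Subgroup.mem_iInf.2 fun g => conj_elemT_mem hn g hij hξ
  have hle' : relElemSubgroup n I ≤ (relElemSubgroup n I).comap (MulAut.conj g).toMonoidHom := by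
    refine (Subgroup.closure_le _).2 ?_
    rintro _ ⟨h, -, y, hy, rfl⟩
    simpa [mul_assoc] using Subgroup.mem_iInf.1 (hle hy) (g * h)
  exact hle' hx

/-- The discrepancy between an elementary matrix and its image under a ring endomorphism
congruent to the identity modulo `J` lies in `E(n,R,J)`. -/
theorem mul_map_inv_mem_relElemSubgroup {J : Ideal R} (σ : R →+* R) (hσ : ∀ ξ, ξ - σ ξ ∈ J)
    {x : Matrix.SpecialLinearGroup (Fin n) R} (hx : x ∈ elemSubgroup n R) :
    x * (Matrix.SpecialLinearGroup.map σ x)⁻¹ ∈ relElemSubgroup n J := by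
  induction hx using Subgroup.closure_induction with
  | mem x hx =>
    obtain ⟨i, j, hij, ξ, rfl⟩ := hx
    rw [map_elemT, elemT_inv, elemT_mul, ← sub_eq_add_neg]
    exact elemT_mem_relElemSubgroup hij (hσ ξ)
  | one => simp
  | mul x y hx hy ihx ihy =>
    have := mul_mem (relElemSubgroup_conj_mem hx ihy) ihx
    simpa [mul_assoc] using this
  | inv x hx ih =>
    have := relElemSubgroup_conj_mem (inv_mem hx) (inv_mem ih)
    simpa [mul_assoc] using this

/-- The standard commutator formula `[E(n,R), SL(n,R,B)] ≤ E(n,R,B)`. -/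
theorem commutator_elemSubgroup_congrSubgroup_le (hn : 3 ≤ n) (B : Ideal R) :
    ⁅elemSubgroup n R, congrSubgroup n B⁆ ≤ relElemSubgroup n B := by
  refine Subgroup.commutator_le.2 fun t ht g hg => ?_
  let D : Subring (R × R) := ((Ideal.Quotient.mk B).comp (RingHom.fst R R)).eqLocus
    ((Ideal.Quotient.mk B).comp (RingHom.snd R R))
  let p : D →+* R := (RingHom.fst R R).comp D.subtype
  let q : D →+* R := (RingHom.snd R R).comp D.subtype
  let δ : R →+* D := ((RingHom.id R).prod (RingHom.id R)).codRestrict D fun _ => rfl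
  have hpδ : p.comp δ = RingHom.id R := rfl
  have hqδ : q.comp δ = RingHom.id R := rfl
  have hgB : ∀ i j, Ideal.Quotient.mk B ((1 : Matrix (Fin n) (Fin n) R) i j) =
      Ideal.Quotient.mk B (g i j) := fun i j => by
    have h := congrArg (fun x : Matrix.SpecialLinearGroup (Fin n) (R ⧸ B) => x i j)
      (MonoidHom.mem_ker.1 hg)
    simpa [Matrix.one_apply, apply_ite (Ideal.Quotient.mk B)] using h.symm
  let M : Matrix (Fin n) (Fin n) D := Matrix.of fun i j =>
    ⟨((1 : Matrix (Fin n) (Fin n) R) i j, g i j), hgB i j⟩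
  have hpM : p.mapMatrix M = 1 := rfl
  have hqM : q.mapMatrix M = g := rfl
  have hM : M.det = 1 := by
    refine Subtype.ext (Prod.ext ?_ ?_)
    · change p M.det = 1
      rw [RingHom.map_det, hpM, Matrix.det_one]
    · change q M.det = 1
      rw [RingHom.map_det, hqM, g.det_coe]
  let g' : Matrix.SpecialLinearGroup (Fin n) D := ⟨M, hM⟩
  have hpg : Matrix.SpecialLinearGroup.map p g' = 1 := Subtype.ext hpM
  have hqg : Matrix.SpecialLinearGroup.map q g' = g := Subtype.ext hqM
  let t' := Matrix.SpecialLinearGroup.map δ t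
  have ht' : t' ∈ elemSubgroup n D := map_mem_elemSubgroup δ ht
  have hqt : Matrix.SpecialLinearGroup.map q t' = t := rfl
  have hnormal : (elemSubgroup n D).Normal := relElemSubgroup_top (R := D) ▸
    relElemSubgroup_normal hn ⊤
  have hmem : ⁅t', g'⁆ ∈ elemSubgroup n D := by
    rw [commutatorElement_def, mul_assoc, mul_assoc, ← mul_assoc g']
    exact mul_mem ht' (hnormal.conj_mem _ (inv_mem ht') _)
  have hrel := mul_map_inv_mem_relElemSubgroup (J := RingHom.ker p) (δ.comp p)
    (fun ξ => by rw [RingHom.mem_ker, map_sub]; exact sub_self (p ξ)) hmem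
  have hone : Matrix.SpecialLinearGroup.map (δ.comp p) ⁅t', g'⁆ = 1 := by
    change Matrix.SpecialLinearGroup.map δ (Matrix.SpecialLinearGroup.map p ⁅t', g'⁆) = 1
    rw [map_commutatorElement, hpg, commutatorElement_one_right, map_one]
  rw [hone, inv_one, mul_one] at hrel
  have hq := map_mem_relElemSubgroup (J := B) q (fun ξ hξ => ?_) hrel
  · rwa [map_commutatorElement, hqt, hqg] at hq
  · have h1 : (ξ : R × R).1 = 0 := hξ
    have h2 : Ideal.Quotient.mk B (ξ : R × R).1 = Ideal.Quotient.mk B (ξ : R × R).2 := ξ.2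
    rw [h1, map_zero] at h2
    exact (Ideal.Quotient.eq_zero_iff_mem (I := B)).1 h2.symm

theorem relElemSubgroup_mul_le_commutator (hn : 3 ≤ n) (A B : Ideal R) :
    relElemSubgroup n (A * B) ≤ ⁅relElemSubgroup n A, relElemSubgroup n B⁆ := by
  have := relElemSubgroup_normal hn A
  have := relElemSubgroup_normal hn B
  refine relElemSubgroup_le (fun h _ x hx => Subgroup.Normal.conj_mem inferInstance x hx h)
    fun i j hij ξ hξ => ?_
  obtain ⟨k, hik, hkj⟩ := exists_ne_ne hn i j
  induction hξ using Submodule.mul_induction_on' with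
  | mem_mul_mem a ha b hb =>
    rw [← commutator_elemT hik hkj]
    exact Subgroup.commutator_mem_commutator (elemT_mem_relElemSubgroup hik ha)
      (elemT_mem_relElemSubgroup hkj hb)
  | add ξ _ ζ _ ihξ ihζ =>
    rw [← elemT_mul]
    exact mul_mem ihξ ihζ

theorem mem_congrSubgroup {I : Ideal R} {g : Matrix.SpecialLinearGroup (Fin n) R} :
    g ∈ congrSubgroup n I ↔ ∀ i j, ((g : Matrix (Fin n) (Fin n) R) - 1) i j ∈ I := by
  rw [congrSubgroup, MonoidHom.mem_ker, Matrix.SpecialLinearGroup.ext_iff]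
  refine forall₂_congr fun i j => ?_
  rw [← Ideal.Quotient.eq_zero_iff_mem, Matrix.sub_apply, map_sub, sub_eq_zero]
  simp [Matrix.one_apply, apply_ite (Ideal.Quotient.mk I)]

theorem relElemSubgroup_le_congrSubgroup (I : Ideal R) :
    relElemSubgroup n I ≤ congrSubgroup n I := by
  refine relElemSubgroup_le (fun h _ x hx => Subgroup.Normal.conj_mem (MonoidHom.normal_ker _) x
    hx h) fun i j hij ξ hξ => ?_
  rw [congrSubgroup, MonoidHom.mem_ker, map_elemT, Ideal.Quotient.eq_zero_iff_mem.2 hξ]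
  exact Subtype.ext (Matrix.transvection_zero i j)

theorem commutator_congrSubgroup_le (A B : Ideal R) :
    ⁅congrSubgroup n A, congrSubgroup n B⁆ ≤ congrSubgroup n (A * B) := by
  refine Subgroup.commutator_le.2 fun g hg h hh => ?_
  rw [mem_congrSubgroup] at hg hh
  have hgh : ∀ i j, ((g.1 - 1) * (h.1 - 1)) i j ∈ A * B :=
    fun i j => by
      rw [Matrix.mul_apply]
      exact sum_mem fun k _ => Ideal.mul_mem_mul (hg i k) (hh k j)
  have hhg : ∀ i j, ((h.1 - 1) * (g.1 - 1)) i j ∈ A * B :=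
    fun i j => by
      rw [Matrix.mul_apply]
      exact sum_mem fun k _ => Ideal.mul_mem_mul_rev (hg k j) (hh i k)
  rw [congrSubgroup, MonoidHom.mem_ker, map_commutatorElement,
    commutatorElement_eq_one_iff_mul_comm, ← map_mul, ← map_mul]
  ext i j
  change Ideal.Quotient.mk (A * B) ((g.1 * h.1) i j) =
    Ideal.Quotient.mk (A * B) ((h.1 * g.1) i j)
  rw [Ideal.Quotient.eq]
  have hcomm : g.1 * h.1 - h.1 * g.1 = (g.1 - 1) * (h.1 - 1) - (h.1 - 1) * (g.1 - 1) := by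
    noncomm_ring
  rw [← Matrix.sub_apply, hcomm]
  exact sub_mem (hgh i j) (hhg i j)

/-- The three subgroups lemma relative to a normal subgroup. -/
theorem commutator_commutator_le_of_rotate {G : Type*} [Group G] {H K L N : Subgroup G} [N.Normal]
    (h1 : ⁅⁅K, L⁆, H⁆ ≤ N) (h2 : ⁅⁅L, H⁆, K⁆ ≤ N) : ⁅⁅H, K⁆, L⁆ ≤ N := by
  rw [← QuotientGroup.ker_mk' N, ← (Subgroup.map_eq_bot_iff _), Subgroup.map_commutator,
    Subgroup.map_commutator] at h1 h2 ⊢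
  exact Subgroup.commutator_commutator_eq_bot_of_rotate h1 h2

end Elementary

/-- For n ≥ 3 and ideals A, B of R:
[E(n,R,A), SL(n,R,B)] = [E(n,R,A), E(n,R,B)]. -/
theorem relative_commutator_formula (n : ℕ) (hn : 3 ≤ n)
    (R : Type*) [CommRing R] (A B : Ideal R) :
    ⁅relElemSubgroup n A, congrSubgroup n B⁆ =
      ⁅relElemSubgroup n A, relElemSubgroup n B⁆ := by
  have hA := relElemSubgroup_normal hn A
  have hB := relElemSubgroup_normal hn B
  refine le_antisymm ?_ (Subgroup.commutator_mono le_rfl (relElemSubgroup_le_congrSubgroup B))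
  calc ⁅relElemSubgroup n A, congrSubgroup n B⁆
      ≤ ⁅⁅relElemSubgroup n A, elemSubgroup n R⁆, congrSubgroup n B⁆ :=
        Subgroup.commutator_mono (by
          simpa [relElemSubgroup_top] using relElemSubgroup_mul_le_commutator hn A ⊤) le_rfl
    _ ≤ ⁅relElemSubgroup n A, relElemSubgroup n B⁆ := by
        refine commutator_commutator_le_of_rotate ?_ ?_
        · rw [Subgroup.commutator_comm]
          exact Subgroup.commutator_mono le_rfl (commutator_elemSubgroup_congrSubgroup_le hn B)
        · rw [Subgroup.commutator_comm, Subgroup.commutator_comm (congrSubgroup n B)]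
          refine le_trans (Subgroup.commutator_mono le_rfl ?_)
            ((commutator_elemSubgroup_congrSubgroup_le hn (A * B)).trans
              (relElemSubgroup_mul_le_commutator hn A B))
          exact (Subgroup.commutator_mono (relElemSubgroup_le_congrSubgroup A) le_rfl).trans
            (commutator_congrSubgroup_le A B)
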